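/- Let L be a self-dual Lagrangian matroid on J = [n] ∪ [n]*. Then for every i ∈ [n], the induced minimal access structure Γ_{i,min} is a valid quantum access structure: any two members A', B' of Γ_{i,min} satisfy A' ∩ B' ≠ ∅. Consequently, every self-dual Lagrangian matroid induces a quantum secret sharing scheme. -/

import Mathlib

open Matrix Finset

abbrev J (n : ℕ) := Fin n ⊕ Fin n

/-- The involution `i ↔ i*` on `J n = [n] ∪ [n]*`. -/
def starJ {n : ℕ} : J n → J n := Sum.swap

/-- A subset `S ⊆ J` is admissible if `S ∩ S* = ∅`. -/
def Admissible {n : ℕ} (S : Finset (J n)) : Prop := ∀ x ∈ S, starJ x ∉ S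

/-- Rank function realizing the standard order `n > ... > 1 > 1* > ... > n*` on `J n`. -/
def stdRank {n : ℕ} : J n → ℤ
  | Sum.inl i => (i : ℤ) + 1
  | Sum.inr i => -((i : ℤ) + 1)

/-- A permutation of `J` is admissible if it commutes with the involution. -/
def IsAdmissiblePerm {n : ℕ} (w : Equiv.Perm (J n)) : Prop :=
  ∀ x, w (starJ x) = starJ (w x)

/-- The key function inducing the order `≤^w`: `i ≤^w j ↔ keyFun w i ≤ keyFun w j`. -/
def keyFun {n : ℕ} (w : Equiv.Perm (J n)) : J n → ℤ := fun x => stdRank (w.symm x)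

/-- `A ≤^w B` : listing `A` and `B` in increasing `≤^w` order as `a_1, ..., a_k` and
`b_1, ..., b_k`, we have `a_i ≤^w b_i` for all `i`.  (Implemented by comparing the
images of `A` and `B` under the order embedding `keyFun w : J n → ℤ`.) -/
def GaleLE {n : ℕ} (w : Equiv.Perm (J n)) (A B : Finset (J n)) : Prop :=
  ∃ (k : ℕ) (hA : (A.image (keyFun w)).card = k) (hB : (B.image (keyFun w)).card = k),
    ∀ i : Fin k, ((A.image (keyFun w)).orderIsoOfFin hA i : ℤ) ≤
      ((B.image (keyFun w)).orderIsoOfFin hB i : ℤ)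

/-- The Maximality condition on a collection of admissible subsets of `J n`:
for every admissible permutation `w` there is a member dominating all members in `≤^w`. -/
def MaximalityCondition {n : ℕ} (ℬ : Set (Finset (J n))) : Prop :=
  ∀ w : Equiv.Perm (J n), IsAdmissiblePerm w → ∃ B ∈ ℬ, ∀ A ∈ ℬ, GaleLE w A B

/-- `ℬ` is the collection of bases of a Lagrangian matroid on `J n`: a nonempty collection
of admissible `n`-subsets (transversals) satisfying the Maximality condition. -/
def IsLagrangian {n : ℕ} (ℬ : Set (Finset (J n))) : Prop :=
  ℬ.Nonempty ∧ (∀ B ∈ ℬ, Admissible B ∧ B.card = n) ∧ MaximalityCondition ℬ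

/-- An admissible set is independent in `ℬ` if it is contained in some member of `ℬ`. -/
def IndepIn {n : ℕ} (ℬ : Set (Finset (J n))) (S : Finset (J n)) : Prop :=
  Admissible S ∧ ∃ B ∈ ℬ, S ⊆ B

/-- An admissible set is dependent in `ℬ` if it is contained in no member of `ℬ`. -/
def DepIn {n : ℕ} (ℬ : Set (Finset (J n))) (S : Finset (J n)) : Prop :=
  Admissible S ∧ ¬ ∃ B ∈ ℬ, S ⊆ B

/-- A circuit is a minimal dependent admissible set: it is dependent and every proper
subset is independent. -/
def IsCircuitIn {n : ℕ} (ℬ : Set (Finset (J n))) (C : Finset (J n)) : Prop :=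
  DepIn ℬ C ∧ ∀ T : Finset (J n), T ⊂ C → IndepIn ℬ T

/-- The map `φ : J → [n]` with `φ(i) = φ(i*) = i`. -/
def phi {n : ℕ} : J n → Fin n := Sum.elim id id

/-- The minimal access structure `Γ_{i,min}` induced by a Lagrangian matroid with bases `ℬ`,
treating `i ∈ [n]` as the dealer:
`Γ_{i,min} = {φ(A) : A admissible, i, i* ∉ A, A ∪ {i} ∈ 𝓒 or A ∪ {i*} ∈ 𝓒}`. -/
def accessStructure {n : ℕ} (ℬ : Set (Finset (J n))) (i : Fin n) :
    Set (Finset (Fin n)) :=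
  {T | ∃ A : Finset (J n), Admissible A ∧ Sum.inl i ∉ A ∧ Sum.inr i ∉ A ∧
    (IsCircuitIn ℬ (insert (Sum.inl i) A) ∨ IsCircuitIn ℬ (insert (Sum.inr i) A)) ∧
    T = A.image phi}

section LagrangianHelpers

variable {n : ℕ}

lemma starJ_starJ (x : J n) : starJ (starJ x) = x := Sum.swap_swap x

lemma starJ_ne (x : J n) : starJ x ≠ x := by
  rcases x with j | j <;> simp [starJ]

lemma phi_starJ (x : J n) : phi (starJ x) = phi x := by
  rcases x with j | j <;> rfl

lemma eq_or_eq_starJ_of_phi_eq {x y : J n} (h : phi x = phi y) : x = y ∨ x = starJ y := by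
  rcases x with j | j <;> rcases y with k | k <;> simp_all [phi, starJ]

lemma stdRank_injective : Function.Injective (stdRank (n := n)) := by
  rintro (j | j) (k | k) h <;> simp only [stdRank] at h
  · exact congrArg Sum.inl (Fin.ext (by omega))
  · omega
  · omega
  · exact congrArg Sum.inr (Fin.ext (by omega))

lemma keyFun_injective (w : Equiv.Perm (J n)) : Function.Injective (keyFun w) :=
  stdRank_injective.comp w.symm.injective

/-- The number of elements of `s` lying in `V`, counted along the increasing enumeration. -/
lemma card_inter_eq_card_filter {s : Finset ℤ} {k : ℕ} (hs : s.card = k) (V : Finset ℤ) :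
    (s ∩ V).card = (univ.filter fun i : Fin k => (s.orderIsoOfFin hs i : ℤ) ∈ V).card := by
  symm
  refine card_bij (fun i _ => (s.orderIsoOfFin hs i : ℤ)) ?_ ?_ ?_
  · intro i hi
    exact mem_inter.2 ⟨(s.orderIsoOfFin hs i).2, (mem_filter.1 hi).2⟩
  · intro i _ j _ h
    exact (s.orderIsoOfFin hs).injective (Subtype.ext h)
  · intro b hb
    obtain ⟨hbs, hbV⟩ := mem_inter.1 hb
    exact ⟨(s.orderIsoOfFin hs).symm ⟨b, hbs⟩, mem_filter.2 ⟨mem_univ _, by rwa [OrderIso.apply_symm_apply]⟩,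
      by simp⟩

/-- Componentwise domination implies that `B` meets every up-set at least as often as `A`. -/
lemma GaleLE.card_inter_le {w : Equiv.Perm (J n)} {A B U : Finset (J n)} (h : GaleLE w A B)
    (hU : ∀ x ∈ U, ∀ y, keyFun w x ≤ keyFun w y → y ∈ U) :
    (A ∩ U).card ≤ (B ∩ U).card := by
  obtain ⟨k, hA, hB, hle⟩ := h
  have hinj := keyFun_injective w
  rw [← card_image_of_injective (A ∩ U) hinj, ← card_image_of_injective (B ∩ U) hinj,
    image_inter _ _ hinj, image_inter _ _ hinj, card_inter_eq_card_filter hA,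
    card_inter_eq_card_filter hB]
  refine card_le_card fun i hi => ?_
  rw [mem_filter] at hi ⊢
  refine ⟨hi.1, ?_⟩
  obtain ⟨x, hx, hxi⟩ := mem_image.1 hi.2
  obtain ⟨y, -, hyi⟩ := mem_image.1 ((B.image (keyFun w)).orderIsoOfFin hB i).2
  rw [← hyi]
  refine mem_image_of_mem _ (hU x hx y ?_)
  rw [hxi, hyi]
  exact hle i

/-- The permutation of `J n` exchanging `j` and `j*` for every `j ∈ T`. -/
def flipOn (T : Finset (Fin n)) : Equiv.Perm (J n) :=
  Function.Involutive.toPerm (fun x => if phi x ∈ T then starJ x else x) fun x => by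
    by_cases h : phi x ∈ T <;> simp [h, phi_starJ, starJ_starJ]

lemma flipOn_apply (T : Finset (Fin n)) (x : J n) :
    flipOn T x = if phi x ∈ T then starJ x else x := rfl

lemma flipOn_starJ (T : Finset (Fin n)) (x : J n) :
    flipOn T (starJ x) = starJ (flipOn T x) := by
  simp only [flipOn_apply, phi_starJ]
  split <;> rfl

/-- Any two nested admissible sets are up-sets of `≤^w` for some admissible `w`. -/
lemma exists_admissiblePerm_upset {P Q : Finset (J n)} (hPQ : P ⊆ Q) (hQ : Admissible Q) :
    ∃ w : Equiv.Perm (J n), IsAdmissiblePerm w ∧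
      (∀ x ∈ P, ∀ y, keyFun w x ≤ keyFun w y → y ∈ P) ∧
      (∀ x ∈ Q, ∀ y, keyFun w x ≤ keyFun w y → y ∈ Q) := by
  classical
  set c : Fin n → ℕ := fun j =>
    (if j ∈ P.image phi then 1 else 0) + (if j ∈ Q.image phi then 1 else 0) with hc
  set s : Equiv.Perm (Fin n) := (Tuple.sort c).symm with hs
  have hmono : ∀ j k, s j ≤ s k → c j ≤ c k := by
    intro j k h
    simpa [hs] using Tuple.monotone_sort c h
  set T : Finset (Fin n) := univ.filter fun j => Sum.inr j ∈ Q with hT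
  set u : Equiv.Perm (J n) := (flipOn T).trans (Equiv.sumCongr s s) with hu
  have hustar : ∀ x, u (starJ x) = starJ (u x) := by
    intro x
    simp only [hu, Equiv.trans_apply, flipOn_starJ]
    rcases flipOn T x with j | j <;> rfl
  have huQ : ∀ x ∈ Q, u x = Sum.inl (s (phi x)) := by
    rintro (j | j) hx
    · have : Sum.inr j ∉ Q := hQ _ hx
      simp [hu, flipOn_apply, hT, phi, this]
    · simp [hu, flipOn_apply, hT, phi, hx, starJ]
  have hphi : ∀ y k, u y = Sum.inl k → s (phi y) = k := by
    intro y k h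
    rcases y with j | j <;> by_cases hj : j ∈ T <;>
      simp [hu, flipOn_apply, phi, starJ, hj] at h ⊢ <;> exact h
  have key : ∀ x ∈ Q, ∀ y, stdRank (u x) ≤ stdRank (u y) →
      c (phi x) ≤ c (phi y) ∧ starJ y ∉ Q := by
    intro x hx y h
    rw [huQ x hx] at h
    rcases hy : u y with k | k
    · rw [hy] at h
      simp only [stdRank] at h
      refine ⟨hmono _ _ ?_, fun hyQ => ?_⟩
      · rw [hphi y k hy, Fin.le_def]
        omega
      · have := huQ _ hyQ
        rw [hustar, hy] at this
        simp [starJ] at this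
    · rw [hy] at h
      simp only [stdRank] at h
      omega
  have lift : ∀ R ⊆ Q, ∀ y, starJ y ∉ Q → phi y ∈ R.image phi → y ∈ R := by
    intro R hR y hy hyR
    obtain ⟨z, hz, hzy⟩ := mem_image.1 hyR
    rcases eq_or_eq_starJ_of_phi_eq hzy with rfl | rfl
    · exact hz
    · exact absurd (hR hz) hy
  refine ⟨u.symm, fun x => ?_, ?_, ?_⟩
  · rw [Equiv.symm_apply_eq, hustar, Equiv.apply_symm_apply]
  · intro x hx y h
    obtain ⟨h1, h2⟩ := key x (hPQ hx) y h
    refine lift P hPQ y h2 ?_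
    by_contra hy
    have hxP := mem_image_of_mem phi hx
    have hxQ := mem_image_of_mem phi (hPQ hx)
    simp only [hc, if_pos hxP, if_pos hxQ, if_neg hy] at h1
    split at h1 <;> omega
  · intro x hx y h
    obtain ⟨h1, h2⟩ := key x hx y h
    refine lift Q subset_rfl y h2 ?_
    by_contra hy
    have hyP : phi y ∉ P.image phi := fun h => hy (image_subset_image hPQ h)
    have hxQ := mem_image_of_mem phi hx
    simp only [hc, if_pos hxQ, if_neg hy, if_neg hyP] at h1
    omega

variable {ℬ : Set (Finset (J n))}

/-- Some basis simultaneously maximizes the intersections with two nested admissible sets. -/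
lemma IsLagrangian.exists_maximal_inter (hL : IsLagrangian ℬ) {P Q : Finset (J n)}
    (hPQ : P ⊆ Q) (hQ : Admissible Q) :
    ∃ M ∈ ℬ, ∀ X ∈ ℬ, (X ∩ P).card ≤ (M ∩ P).card ∧ (X ∩ Q).card ≤ (M ∩ Q).card := by
  obtain ⟨w, hw, hP, hQ'⟩ := exists_admissiblePerm_upset hPQ hQ
  obtain ⟨M, hM, hmax⟩ := hL.2.2 w hw
  exact ⟨M, hM, fun X hX => ⟨(hmax X hX).card_inter_le hP, (hmax X hX).card_inter_le hQ'⟩⟩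

lemma Admissible.mem_or_starJ_mem {M : Finset (J n)} (hM : Admissible M) (hcard : M.card = n)
    (x : J n) : x ∈ M ∨ starJ x ∈ M := by
  have hinj : Set.InjOn phi (M : Set (J n)) := by
    intro y hy z hz h
    rcases eq_or_eq_starJ_of_phi_eq h with h | rfl
    · exact h
    · exact absurd hy (hM z hz)
  have huniv : M.image phi = univ := by
    rw [← card_eq_iff_eq_univ, card_image_of_injOn hinj, hcard, Fintype.card_fin]
  obtain ⟨y, hy, hyx⟩ := mem_image.1 (huniv ▸ mem_univ (phi x))
  rcases eq_or_eq_starJ_of_phi_eq hyx with rfl | rfl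
  · exact Or.inl hy
  · exact Or.inr hy

/-- If `A` is independent and `A ∪ {x}` is not, then for any admissible `S ∪ {x}` with `A ⊆ S`
some basis avoiding `x` meets `S` in at least as many elements as any basis meets `S ∪ {x}`. -/
lemma IsLagrangian.exists_starJ_mem_of_dependent (hL : IsLagrangian ℬ) {A S : Finset (J n)}
    {x : J n} (hAS : A ⊆ S) (hS : Admissible (insert x S)) (hA : ∃ X ∈ ℬ, A ⊆ X)
    (hxA : ¬ ∃ X ∈ ℬ, insert x A ⊆ X) :
    ∃ M ∈ ℬ, starJ x ∈ M ∧ ∀ X ∈ ℬ, (X ∩ insert x S).card ≤ (M ∩ S).card := by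
  obtain ⟨M, hM, hmax⟩ := hL.exists_maximal_inter (hAS.trans (subset_insert x S)) hS
  obtain ⟨X, hX, hAX⟩ := hA
  have hAM : A ⊆ M := by
    have h := (hmax X hX).1
    rw [inter_eq_right.2 hAX] at h
    exact inter_eq_right.1 (eq_of_subset_of_card_le inter_subset_right h)
  have hxM : x ∉ M := fun hx => hxA ⟨M, hM, insert_subset hx hAM⟩
  refine ⟨M, hM, ?_, fun Y hY => ?_⟩
  · exact ((hL.2.1 M hM).1.mem_or_starJ_mem (hL.2.1 M hM).2 x).resolve_left hxM
  · have h := (hmax Y hY).2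
    rwa [inter_insert_of_notMem hxM] at h

/-- Two circuits of a Lagrangian matroid cannot span exactly one skew pair `{x, x*}`. -/
lemma IsLagrangian.false_of_unique_skew_pair (hL : IsLagrangian ℬ) {A B : Finset (J n)} {x : J n}
    (hx : Admissible (insert x (A ∪ B))) (hx' : Admissible (insert (starJ x) (A ∪ B)))
    (hA : ∃ X ∈ ℬ, A ⊆ X) (hxA : ¬ ∃ X ∈ ℬ, insert x A ⊆ X)
    (hB : ∃ X ∈ ℬ, B ⊆ X) (hxB : ¬ ∃ X ∈ ℬ, insert (starJ x) B ⊆ X) : False := by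
  obtain ⟨M, hM, hxM, hmax⟩ :=
    hL.exists_starJ_mem_of_dependent subset_union_left hx hA hxA
  obtain ⟨N, hN, hxN, hmax'⟩ :=
    hL.exists_starJ_mem_of_dependent subset_union_right hx' hB hxB
  rw [starJ_starJ] at hxN
  have h1 := hmax N hN
  have h2 := hmax' M hM
  have hnot : x ∉ A ∪ B := fun h => hx' (starJ x) (mem_insert_self _ _)
    (by rw [starJ_starJ]; exact mem_insert_of_mem h)
  have hnot' : starJ x ∉ A ∪ B := fun h => hx x (mem_insert_self _ _) (mem_insert_of_mem h)
  rw [inter_insert_of_mem hxN, card_insert_of_notMem fun h => hnot (mem_inter.1 h).2] at h1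
  rw [inter_insert_of_mem hxM, card_insert_of_notMem fun h => hnot' (mem_inter.1 h).2] at h2
  omega

lemma Admissible.insert_union {A B : Finset (J n)} {x : J n} (hA : Admissible A)
    (hB : Admissible B) (hAB : Disjoint (A.image phi) (B.image phi))
    (hxA : phi x ∉ A.image phi) (hxB : phi x ∉ B.image phi) :
    Admissible (insert x (A ∪ B)) := by
  have hmem : ∀ {C : Finset (J n)} {y}, starJ y ∈ C → phi y ∈ C.image phi := fun {C y} h =>
    phi_starJ y ▸ mem_image_of_mem phi h
  have hd := disjoint_left.1 hAB
  have hstar : ∀ {y}, starJ y = x → phi y = phi x := fun h => by rw [← h, phi_starJ]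
  intro y hy hy'
  simp only [mem_insert, mem_union] at hy hy'
  rcases hy with rfl | hy | hy
  · rcases hy' with h | h | h
    · exact starJ_ne _ h
    · exact hxA (hmem h)
    · exact hxB (hmem h)
  · rcases hy' with h | h | h
    · exact hxA (hstar h ▸ mem_image_of_mem phi hy)
    · exact hA y hy h
    · exact hd (mem_image_of_mem phi hy) (hmem h)
  · rcases hy' with h | h | h
    · exact hxB (hstar h ▸ mem_image_of_mem phi hy)
    · exact hd (hmem h) (mem_image_of_mem phi hy)
    · exact hB y hy h

lemma image_starJ_image_starJ (S : Finset (J n)) : (S.image starJ).image starJ = S := by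
  rw [image_image, show (starJ ∘ starJ : J n → J n) = id from funext starJ_starJ, image_id]

lemma image_phi_image_starJ (S : Finset (J n)) : (S.image starJ).image phi = S.image phi := by
  rw [image_image, show (phi ∘ starJ : J n → Fin n) = phi from funext phi_starJ]

lemma Admissible.image_starJ {S : Finset (J n)} (hS : Admissible S) :
    Admissible (S.image starJ) := by
  intro y hy hy'
  obtain ⟨x, hx, rfl⟩ := mem_image.1 hy
  obtain ⟨z, hz, hzx⟩ := mem_image.1 hy'
  exact hS z hz (by rwa [hzx, starJ_starJ])

lemma exists_basis_image_starJ (hsd : (fun B => B.image starJ) '' ℬ = ℬ) {S : Finset (J n)}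
    (h : ∃ X ∈ ℬ, S ⊆ X) : ∃ X ∈ ℬ, S.image starJ ⊆ X := by
  obtain ⟨X, hX, hSX⟩ := h
  exact ⟨X.image starJ, hsd ▸ Set.mem_image_of_mem (fun B => B.image starJ) hX,
    image_subset_image hSX⟩

lemma IsCircuitIn.exists_basis_of_insert {A : Finset (J n)} {x : J n}
    (h : IsCircuitIn ℬ (insert x A)) (hx : x ∉ A) : ∃ X ∈ ℬ, A ⊆ X :=
  (h.2 A (ssubset_insert hx)).2

/-- In a self-dual Lagrangian matroid every member of `Γ_{i,min}` arises from a circuit through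
any prescribed `x ∈ {i, i*}`. -/
lemma exists_of_mem_accessStructure (hsd : (fun B => B.image starJ) '' ℬ = ℬ) {i : Fin n}
    {T : Finset (Fin n)} (hT : T ∈ accessStructure ℬ i) {x : J n} (hx : phi x = i) :
    ∃ A : Finset (J n), Admissible A ∧ i ∉ A.image phi ∧ T = A.image phi ∧
      (∃ X ∈ ℬ, A ⊆ X) ∧ ¬ ∃ X ∈ ℬ, insert x A ⊆ X := by
  obtain ⟨A, hA, hl, hr, hcirc, rfl⟩ := hT
  have hi : i ∉ A.image phi := by
    intro h
    obtain ⟨y | y, hy, rfl⟩ := mem_image.1 h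
    · exact hl hy
    · exact hr hy
  obtain ⟨y, hyi, hcirc⟩ : ∃ y : J n, phi y = i ∧ IsCircuitIn ℬ (insert y A) :=
    hcirc.elim (fun h => ⟨Sum.inl i, rfl, h⟩) fun h => ⟨Sum.inr i, rfl, h⟩
  have hyA : y ∉ A := fun h => hi (hyi ▸ mem_image_of_mem phi h)
  have hind := hcirc.exists_basis_of_insert hyA
  rcases eq_or_eq_starJ_of_phi_eq (hx.trans hyi.symm) with rfl | rfl
  · exact ⟨A, hA, hi, rfl, hind, hcirc.1.2⟩
  · refine ⟨A.image starJ, hA.image_starJ, ?_, (image_phi_image_starJ A).symm,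
      exists_basis_image_starJ hsd hind, fun h => hcirc.1.2 ?_⟩
    · rwa [image_phi_image_starJ]
    · rw [← image_insert] at h
      simpa only [image_starJ_image_starJ] using exists_basis_image_starJ hsd h

end LagrangianHelpers

/-- Let `L` be a self-dual Lagrangian matroid on `J = [n] ∪ [n]*` with
bases `ℬ`. Then for every `i ∈ [n]` the induced minimal access structure `Γ_{i,min}` is a
valid quantum access structure: any two of its members intersect. Consequently every
self-dual Lagrangian matroid induces a quantum secret sharing scheme. -/
theorem statement9 {n : ℕ} (ℬ : Set (Finset (J n)))
    (hL : IsLagrangian ℬ)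
    (hsd : (fun B => B.image starJ) '' ℬ = ℬ) :
    ∀ i : Fin n, ∀ A' ∈ accessStructure ℬ i, ∀ B' ∈ accessStructure ℬ i,
      (A' ∩ B').Nonempty := by
  intro i A' hA' B' hB'
  obtain ⟨A, hA, hiA, rfl, hindA, hdepA⟩ :=
    exists_of_mem_accessStructure hsd hA' (x := Sum.inl i) rfl
  obtain ⟨B, hB, hiB, rfl, hindB, hdepB⟩ :=
    exists_of_mem_accessStructure hsd hB' (x := starJ (Sum.inl i)) rfl
  rw [← not_disjoint_iff_nonempty_inter]
  intro hAB
  exact hL.false_of_unique_skew_pair (x := Sum.inl i)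
    (hA.insert_union hB hAB hiA hiB) (hA.insert_union hB hAB hiA hiB) hindA hdepA hindB hdepB
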